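/- Let n ≥ 3 and let u ∈ A_{n,1} satisfy δ_n(u) = 0. Then there exists w ∈ A_{n+1,1} such that δ_{n+1}(w) = u. -/

import Mathlib

open Finset

/-- A list `[m_1, …, m_n]` of natural numbers is an Anick chain if it is nonempty,
`m_j ≥ 2` for all `1 ≤ j ≤ n-2`, and (when `n ≥ 2`) either `m_{n-1} ≥ 2` or
`(m_{n-1}, m_n) = (1, 0)`. -/
def AnickChain (l : List ℕ) : Prop :=
  l ≠ [] ∧ (∀ j, j + 2 < l.length → 2 ≤ l.getD j 0) ∧
    (2 ≤ l.length →
      2 ≤ l.getD (l.length - 2) 0 ∨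
        (l.getD (l.length - 2) 0 = 1 ∧ l.getD (l.length - 1) 0 = 0))

/-- The ℚ-vector space with basis the set of all Anick chains (of all lengths);
its length-homogeneous components are the spaces `A_n`. -/
abbrev AnickSpace : Type := {l : List ℕ // AnickChain l} →₀ ℚ

open Classical in
/-- The basis element `[m_1|…|m_n]` attached to a list; by convention it is `0`
if the list is not an Anick chain. -/
noncomputable def br (l : List ℕ) : AnickSpace :=
  if h : AnickChain l then Finsupp.single ⟨l, h⟩ 1 else 0

/-- The `j`-th entry of a list, `1`-based (with default value 0). -/
def ent (l : List ℕ) (j : ℕ) : ℕ := l.getD (j - 1) 0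

/-- Replace the pair of entries at (1-based) positions `j, j+1` by the single entry `c`. -/
def mergeAt (l : List ℕ) (j c : ℕ) : List ℕ := l.take (j - 1) ++ c :: l.drop (j + 1)

/-- Decrease the (1-based) `t`-th entry by one. -/
def decAt (l : List ℕ) (t : ℕ) : List ℕ := l.set (t - 1) (ent l t - 1)

open Classical in
/-- The value of the Anick differential on the basis chain `[i_1|…|i_{n+1}]`. -/
noncomputable def deltaFun (l : List ℕ) : AnickSpace :=
  let n := l.length - 1
  let i : ℕ → ℚ := fun j => (ent l j : ℚ)
  if 2 ≤ ent l n then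
    (∑ j ∈ Icc 1 n, ((-1 : ℚ) ^ j * (i j * (i j - 1) / (i j + i (j + 1) - 1))) •
        br (mergeAt l j (ent l j + ent l (j + 1) - 1)))
    + (∑ j ∈ Icc 2 n, ∑ t ∈ Icc 1 (j - 1),
        ((-1 : ℚ) ^ j * (i t * (i j - 1) * (i (j + 1) - 1) / (i j + i (j + 1) - 1))) •
          br (mergeAt (decAt l t) j (ent l j + ent l (j + 1))))
    + (∑ j ∈ Icc 2 n, ∑ t ∈ Icc 1 (j - 1),
        ((-1 : ℚ) ^ j * (i j * i (j + 1) * (i t - 1) / (i j + i (j + 1) - 1))) •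
          br (mergeAt l j (ent l j + ent l (j + 1) - 1)))
  else if ent l n = 1 ∧ ent l (n + 1) = 0 then
    (∑ j ∈ Icc 1 (n - 2), ((-1 : ℚ) ^ j * (i j * (i j - 1) / (i j + i (j + 1) - 1))) •
        br (mergeAt l j (ent l j + ent l (j + 1) - 1)))
    + (∑ j ∈ Icc 2 (n - 2), ∑ t ∈ Icc 1 (j - 1),
        ((-1 : ℚ) ^ j * (i t * (i j - 1) * (i (j + 1) - 1) / (i j + i (j + 1) - 1))) •
          br (mergeAt (decAt l t) j (ent l j + ent l (j + 1))))
    + (∑ j ∈ Icc 2 (n - 2), ∑ t ∈ Icc 1 (j - 1),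
        ((-1 : ℚ) ^ j * (i j * i (j + 1) * (i t - 1) / (i j + i (j + 1) - 1))) •
          br (mergeAt l j (ent l j + ent l (j + 1) - 1)))
    + (∑ j ∈ Icc 1 (n - 1), ((-1 : ℚ) ^ n * i j) • br ((decAt l j).dropLast))
    + (∑ j ∈ Icc 1 (n - 1), ((-1 : ℚ) ^ (n - 1) * (i j - 1)) • br (l.take (n - 1) ++ [0]))
    + ((-1 : ℚ) ^ n • br (l.take (n - 1) ++ [0]))
  else 0

/-- The Anick differential `δ` (the direct sum of all the maps `δ_n`; on the
length-one component it vanishes, i.e. `δ_1 = 0`). -/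
noncomputable def anickDelta : AnickSpace →ₗ[ℚ] AnickSpace :=
  Finsupp.linearCombination ℚ (fun c => deltaFun c.1)

/-- The value of `∂̃` on a basis chain. -/
noncomputable def dtilFun (l : List ℕ) : AnickSpace :=
  ∑ j ∈ Finset.range l.length, (l.getD j 0 : ℚ) • br (l.set j (l.getD j 0 - 1))

/-- The derivation `∂̃` on the Anick complex. -/
noncomputable def dtil : AnickSpace →ₗ[ℚ] AnickSpace :=
  Finsupp.linearCombination ℚ (fun c => dtilFun c.1)

/-- `A_n`: the span of the Anick chains of length `n`. -/
noncomputable def A (n : ℕ) : Submodule ℚ AnickSpace :=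
  Finsupp.supported ℚ ℚ {c | c.1.length = n}

/-- `A_{n,k}`: the span of the Anick chains of length `n` whose last entry is `≥ k`. -/
noncomputable def Ak (n k : ℕ) : Submodule ℚ AnickSpace :=
  Finsupp.supported ℚ ℚ {c | c.1.length = n ∧ k ≤ c.1.getD (n - 1) 0}

/-- `A_n^{(d)}`: the span of the Anick chains of length `n` and degree `d`. -/
noncomputable def Adeg (n d : ℕ) : Submodule ℚ AnickSpace :=
  Finsupp.supported ℚ ℚ {c | c.1.length = n ∧ c.1.sum = d}

/-- `A_n^{(d)∘}`: the span of the regular Anick chains (all entries `≥ 2`) of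
length `n` and degree `d`. -/
noncomputable def Areg (n d : ℕ) : Submodule ℚ AnickSpace :=
  Finsupp.supported ℚ ℚ {c | c.1.length = n ∧ c.1.sum = d ∧ ∀ j < n, 2 ≤ c.1.getD j 0}

/-- `K_n = ker ∂̃_n ⊆ A_n`. -/
noncomputable def K (n : ℕ) : Submodule ℚ AnickSpace := A n ⊓ LinearMap.ker dtil

/-- `K_n^{(d)} = K_n ∩ A_n^{(d)}`. -/
noncomputable def Kdeg (n d : ℕ) : Submodule ℚ AnickSpace := K n ⊓ Adeg n d

open Classical in
/-- The component map `a ↦ a_i`: keep only the chains whose last entry is `i`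
and delete that last entry. -/
noncomputable def component (i : ℕ) : AnickSpace →ₗ[ℚ] AnickSpace :=
  Finsupp.linearCombination ℚ
    (fun c => if c.1.getLast? = some i then br c.1.dropLast else 0)

/-- The elements `e_1 = [1|0]` and `e_d = Σ_{s=0}^{d-2} (-1)^s C(d,s) [d-s|s]` for `d ≥ 3`. -/
noncomputable def eElt (d : ℕ) : AnickSpace :=
  if d = 1 then br [1, 0]
  else ∑ s ∈ Finset.range (d - 1), ((-1 : ℚ) ^ s * (d.choose s : ℚ)) • br [d - s, s]

theorem anickChain_concat_iff {l : List ℕ} {m : ℕ} (hm : m ≠ 0) :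
    AnickChain (l ++ [m]) ↔ ∀ a ∈ l, 2 ≤ a := by
  constructor
  · rintro ⟨-, h1, h2⟩ a ha
    obtain ⟨i, hi, rfl⟩ := List.getElem_of_mem ha
    by_cases hlast : i + 1 = l.length
    · have h := h2 (by simp; omega)
      have hsub : l.length + 1 - 2 = i := by omega
      simpa [hsub, hi, hm, List.getElem?_append_left hi] using h
    · simpa [hi, List.getElem?_append_left hi] using h1 i (by simp; omega)
  · intro h
    refine ⟨by simp, fun j hj => ?_, fun hl => Or.inl ?_⟩
    · have hj' : j < l.length := by simp at hj; omega
      simpa [hj', List.getElem?_append_left hj'] using h _ (List.getElem_mem hj')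
    · have hj' : l.length - 1 < l.length := by simp at hl; omega
      simpa [hj', List.getElem_append_left hj'] using h _ (List.getElem_mem hj')

theorem AnickChain.two_le_of_two_le_last {l : List ℕ} (hl : AnickChain l)
    (h : 2 ≤ l.getD (l.length - 1) 0) : ∀ a ∈ l, 2 ≤ a := by
  rcases List.eq_nil_or_concat' l with rfl | ⟨l, m, rfl⟩
  · simp
  · have hm : 2 ≤ m := by simpa using h
    rw [anickChain_concat_iff (by omega)] at hl
    simpa [or_imp, forall_and, hm] using hl

theorem anickChain_of_two_le {l : List ℕ} (hne : l ≠ []) (h : ∀ a ∈ l, 2 ≤ a) :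
    AnickChain l := by
  rcases List.eq_nil_or_concat' l with rfl | ⟨l, m, rfl⟩
  · exact absurd rfl hne
  · have hm := h m (by simp)
    rw [anickChain_concat_iff (by omega)]
    exact fun a ha => h a (by simp [ha])

theorem br_of_anickChain {l : List ℕ} (h : AnickChain l) : br l = Finsupp.single ⟨l, h⟩ 1 :=
  dif_pos h

theorem br_mem_supported {s : Set {l : List ℕ // AnickChain l}} {l : List ℕ}
    (h : ∀ hl : AnickChain l, ⟨l, hl⟩ ∈ s) : br l ∈ Finsupp.supported ℚ ℚ s := by
  by_cases hl : AnickChain l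
  · rw [br_of_anickChain hl]
    exact Finsupp.single_mem_supported ℚ 1 (h hl)
  · simp [br, hl]

/-- The linear map `[m_1|…|m_n] ↦ [m_1|…|m_n|1]`. -/
noncomputable def appendOne : AnickSpace →ₗ[ℚ] AnickSpace :=
  Finsupp.linearCombination ℚ (fun c => br (c.1 ++ [1]))

theorem appendOne_br {l : List ℕ} (hne : l ≠ []) : appendOne (br l) = br (l ++ [1]) := by
  by_cases hl : AnickChain l
  · simp [br_of_anickChain hl, appendOne]
  · have h : ¬ AnickChain (l ++ [1]) := fun h =>
      hl (anickChain_of_two_le hne ((anickChain_concat_iff one_ne_zero).1 h))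
    simp [br, hl, h]

/-- The weight `Σ (m_j - 1)` of a list, which the Anick differential preserves. -/
def weight (l : List ℕ) : ℚ := l.sum - l.length

/-- The diagonal map multiplying each chain by a function of its weight. -/
noncomputable def scaleWeight (f : ℚ → ℚ) : AnickSpace →ₗ[ℚ] AnickSpace :=
  Finsupp.linearCombination ℚ (fun c => f (weight c.1) • Finsupp.single c 1)

theorem scaleWeight_single (f : ℚ → ℚ) (c : {l : List ℕ // AnickChain l}) :
    scaleWeight f (Finsupp.single c 1) = f (weight c.1) • Finsupp.single c 1 := by
  simp [scaleWeight]

theorem weight_pos {l : List ℕ} (hne : l ≠ []) (h : ∀ a ∈ l, 2 ≤ a) : 0 < weight l := by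
  have key : ∀ l : List ℕ, (∀ a ∈ l, 2 ≤ a) → 2 * l.length ≤ l.sum := by
    intro l
    induction l with
    | nil => simp
    | cons a l ih =>
      intro h
      have h1 := h a (by simp)
      have h2 := ih fun b hb => h b (by simp [hb])
      simp only [List.length_cons, List.sum_cons]
      omega
  have h1 : (2 * l.length : ℚ) ≤ l.sum := mod_cast key l h
  have h2 : (0 : ℚ) < l.length := mod_cast List.length_pos_iff.2 hne
  unfold weight
  linarith

theorem eq_of_mem_supported {s : Set {l : List ℕ // AnickChain l}}
    {f g : AnickSpace →ₗ[ℚ] AnickSpace}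
    (h : ∀ c ∈ s, f (Finsupp.single c 1) = g (Finsupp.single c 1))
    {x : AnickSpace} (hx : x ∈ Finsupp.supported ℚ ℚ s) : f x = g x := by
  rw [Finsupp.supported_eq_span_single] at hx
  refine LinearMap.eqOn_span (fun y hy => ?_) hx
  obtain ⟨c, hc, rfl⟩ := hy
  exact h c hc

theorem map_mem_of_mem_supported {s : Set {l : List ℕ // AnickChain l}}
    {f : AnickSpace →ₗ[ℚ] AnickSpace} {p : Submodule ℚ AnickSpace}
    (h : ∀ c ∈ s, f (Finsupp.single c 1) ∈ p)
    {x : AnickSpace} (hx : x ∈ Finsupp.supported ℚ ℚ s) : f x ∈ p := by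
  rw [Finsupp.supported_eq_span_single] at hx
  have hle : Submodule.span ℚ ((fun c => Finsupp.single c (1 : ℚ)) '' s) ≤ p.comap f := by
    rw [Submodule.span_le]
    rintro _ ⟨c, hc, rfl⟩
    exact h c hc
  exact hle hx

theorem exists_split {l : List ℕ} {j : ℕ} (h1 : 1 ≤ j) (h2 : j < l.length) :
    ∃ a x y b, l = a ++ x :: y :: b ∧ a.length = j - 1 := by
  refine ⟨l.take (j - 1), l[j - 1], l[j], l.drop (j + 1), ?_, by simp; omega⟩
  have e1 := List.drop_eq_getElem_cons (l := l) (i := j - 1) (by omega)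
  have e2 := List.drop_eq_getElem_cons (l := l) (i := j) h2
  have hj : j - 1 + 1 = j := by omega
  rw [hj] at e1
  rw [← e2, ← e1, List.take_append_drop]

theorem mergeAt_append {a b : List ℕ} {x y c j : ℕ} (hj : 1 ≤ j) (ha : a.length = j - 1) :
    mergeAt (a ++ x :: y :: b) j c = a ++ c :: b := by
  have h : j + 1 = a.length + 2 := by omega
  simp [mergeAt, ← ha, h]

theorem ent_append_left {a b : List ℕ} {j : ℕ} (h1 : 1 ≤ j) (h2 : j ≤ a.length) :
    ent (a ++ b) j = ent a j := by
  have h : j - 1 < a.length := by omega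
  simp [ent, h, List.getElem?_append_left h]

theorem ent_append_fst {a b : List ℕ} {x j : ℕ} (ha : a.length = j - 1) :
    ent (a ++ x :: b) j = x := by
  simp [ent, ← ha]

theorem ent_append_snd {a b : List ℕ} {x y j : ℕ} (hj : 1 ≤ j) (ha : a.length = j - 1) :
    ent (a ++ x :: y :: b) (j + 1) = y := by
  have h : j = a.length + 1 := by omega
  simp [ent, h]

theorem decAt_append {a b : List ℕ} {t : ℕ} (h1 : 1 ≤ t) (h2 : t ≤ a.length) :
    decAt (a ++ b) t = decAt a t ++ b := by
  have h : t - 1 < a.length := by omega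
  rw [decAt, decAt, ent_append_left h1 h2, List.set_append_left _ _ h]

theorem length_decAt (l : List ℕ) (t : ℕ) : (decAt l t).length = l.length := by
  simp [decAt]

theorem sum_decAt {l : List ℕ} {t : ℕ} (h1 : 1 ≤ t) (h2 : t ≤ l.length)
    (h : ∀ a ∈ l, 2 ≤ a) : (decAt l t).sum + 1 = l.sum := by
  have ht : t - 1 < l.length := by omega
  have hx := h _ (List.getElem_mem ht)
  have e := List.drop_eq_getElem_cons ht
  have hs : l.sum = (l.take (t - 1)).sum + (l[t - 1] + (l.drop (t - 1 + 1)).sum) := by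
    rw [← List.sum_cons, ← e, ← List.sum_append, List.take_append_drop]
  have hent : ent l t = l[t - 1] := by simp [ent, ht]
  rw [decAt, hent, List.set_eq_take_append_cons_drop, if_pos ht, List.sum_append, List.sum_cons, hs]
  omega

theorem two_le_last_append_cons {a b : List ℕ} {c : ℕ} (hc : 2 ≤ c) (hb : ∀ x ∈ b, 2 ≤ x) :
    2 ≤ (a ++ c :: b).getD ((a ++ c :: b).length - 1) 0 := by
  rcases List.eq_nil_or_concat' b with rfl | ⟨b, m, rfl⟩
  · simpa using hc
  · have : a ++ c :: (b ++ [m]) = (a ++ c :: b) ++ [m] := by simp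
    rw [this]
    simpa using hb m (by simp)

theorem deltaFun_of_two_le {l : List ℕ} (hl : 2 ≤ l.length) (h : ∀ a ∈ l.dropLast, 2 ≤ a) :
    deltaFun l =
      (∑ j ∈ Icc 1 (l.length - 1), ((-1 : ℚ) ^ j *
        ((ent l j : ℚ) * (ent l j - 1) / (ent l j + ent l (j + 1) - 1))) •
          br (mergeAt l j (ent l j + ent l (j + 1) - 1)))
      + (∑ j ∈ Icc 2 (l.length - 1), ∑ t ∈ Icc 1 (j - 1), ((-1 : ℚ) ^ j *
        ((ent l t : ℚ) * (ent l j - 1) * (ent l (j + 1) - 1) /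
          (ent l j + ent l (j + 1) - 1))) •
            br (mergeAt (decAt l t) j (ent l j + ent l (j + 1))))
      + (∑ j ∈ Icc 2 (l.length - 1), ∑ t ∈ Icc 1 (j - 1), ((-1 : ℚ) ^ j *
        ((ent l j : ℚ) * ent l (j + 1) * (ent l t - 1) / (ent l j + ent l (j + 1) - 1))) •
          br (mergeAt l j (ent l j + ent l (j + 1) - 1))) := by
  have h' : 2 ≤ ent l (l.length - 1) := by
    have hi : l.length - 1 - 1 < l.dropLast.length := by simp; omega
    have := h _ (List.getElem_mem hi)
    rw [List.getElem_dropLast] at this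
    have hi' : l.length - 1 - 1 < l.length := by omega
    simpa [ent, hi'] using this
  simp only [deltaFun]
  rw [if_pos h']

theorem deltaFun_mem_supported {l : List ℕ} (hl : 2 ≤ l.length) (h : ∀ a ∈ l, 2 ≤ a) :
    deltaFun l ∈ Finsupp.supported ℚ ℚ
      {c | weight c.1 = weight l ∧ 2 ≤ c.1.getD (c.1.length - 1) 0} := by
  have merge : ∀ j, 1 ≤ j → j ≤ l.length - 1 →
      br (mergeAt l j (ent l j + ent l (j + 1) - 1)) ∈ Finsupp.supported ℚ ℚ
        {c | weight c.1 = weight l ∧ 2 ≤ c.1.getD (c.1.length - 1) 0} := by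
    intro j h1 h2
    obtain ⟨a, x, y, b, rfl, ha⟩ := exists_split (l := l) h1 (by omega)
    rw [ent_append_fst ha, ent_append_snd h1 ha, mergeAt_append h1 ha]
    have hx := h x (by simp)
    have hy := h y (by simp)
    refine br_mem_supported fun _ => ⟨?_, two_le_last_append_cons (by omega)
      fun z hz => h z (by simp [hz])⟩
    obtain ⟨z, hz⟩ : ∃ z, x + y = z + 1 := ⟨x + y - 1, by omega⟩
    have hz' : (x + y : ℚ) = z + 1 := mod_cast hz
    simp only [weight, hz, Nat.add_sub_cancel, List.sum_append, List.sum_cons, List.length_append,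
      List.length_cons]
    push_cast
    linarith
  have decMerge : ∀ j t, 1 ≤ t → t ≤ j - 1 → j ≤ l.length - 1 →
      br (mergeAt (decAt l t) j (ent l j + ent l (j + 1))) ∈ Finsupp.supported ℚ ℚ
        {c | weight c.1 = weight l ∧ 2 ≤ c.1.getD (c.1.length - 1) 0} := by
    intro j t h1 h2 h3
    have hj : 1 ≤ j := by omega
    obtain ⟨a, x, y, b, rfl, ha⟩ := exists_split (l := l) hj (by omega)
    have hx := h x (by simp)
    rw [ent_append_fst ha, ent_append_snd hj ha, decAt_append h1 (by omega),
      mergeAt_append hj (by rw [length_decAt, ha])]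
    refine br_mem_supported fun _ => ⟨?_, two_le_last_append_cons (by omega)
      fun z hz => h z (by simp [hz])⟩
    have hs : ((decAt a t).sum + 1 : ℚ) = a.sum :=
      mod_cast sum_decAt h1 (by omega) fun z hz => h z (by simp [hz])
    simp only [weight, List.sum_append, List.sum_cons, List.length_append, List.length_cons,
      length_decAt, Nat.cast_add, Nat.cast_one]
    linarith
  rw [deltaFun_of_two_le hl fun a ha => h a (List.mem_of_mem_dropLast ha)]
  refine add_mem (add_mem ?_ ?_) ?_
  · refine sum_mem fun j hj => Submodule.smul_mem _ _ ?_
    rw [mem_Icc] at hj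
    exact merge j hj.1 hj.2
  · refine sum_mem fun j hj => sum_mem fun t ht => Submodule.smul_mem _ _ ?_
    rw [mem_Icc] at hj ht
    exact decMerge j t ht.1 ht.2 hj.2
  · refine sum_mem fun j hj => sum_mem fun t ht => Submodule.smul_mem _ _ ?_
    rw [mem_Icc] at hj
    exact merge j (by omega) hj.2

theorem sum_ent_sub_one (l : List ℕ) :
    ∑ t ∈ Icc 1 l.length, ((ent l t : ℚ) - 1) = weight l := by
  induction l using List.reverseRecOn with
  | nil => simp [weight]
  | append_singleton l m ih =>
    rw [List.length_append, List.length_singleton, Finset.sum_Icc_succ_top (by omega),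
      ent_append_fst (by simp)]
    have : ∑ t ∈ Icc 1 l.length, ((ent (l ++ [m]) t : ℚ) - 1) = weight l := by
      rw [← ih]
      refine Finset.sum_congr rfl fun t ht => ?_
      rw [mem_Icc] at ht
      rw [ent_append_left ht.1 ht.2]
    rw [this]
    simp [weight]
    ring

theorem deltaFun_append_one {l : List ℕ} (hl : 2 ≤ l.length) (h : ∀ a ∈ l, 2 ≤ a) :
    deltaFun (l ++ [1]) =
      appendOne (deltaFun l) + ((-1 : ℚ) ^ l.length * weight l) • br l := by
  obtain ⟨k, hk⟩ : ∃ k, l.length = k + 2 := ⟨l.length - 2, by omega⟩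
  have merge : ∀ j c, 1 ≤ j → j ≤ k + 1 →
      br (mergeAt (l ++ [1]) j c) = appendOne (br (mergeAt l j c)) := by
    intro j c h1 h2
    obtain ⟨a, x, y, b, rfl, ha⟩ := exists_split (l := l) h1 (by omega)
    rw [mergeAt_append h1 ha, appendOne_br (by simp), List.append_assoc, List.cons_append,
      List.cons_append, mergeAt_append h1 ha, List.append_assoc, List.cons_append]
  have decMerge : ∀ j t c, 1 ≤ t → t ≤ j - 1 → j ≤ k + 1 →
      br (mergeAt (decAt (l ++ [1]) t) j c) = appendOne (br (mergeAt (decAt l t) j c)) := by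
    intro j t c h1 h2 h3
    have hj : 1 ≤ j := by omega
    rw [decAt_append h1 (by omega)]
    obtain ⟨a, x, y, b, hab, ha⟩ :=
      exists_split (l := decAt l t) hj (by rw [length_decAt]; omega)
    rw [hab, mergeAt_append hj ha, appendOne_br (by simp), List.append_assoc, List.cons_append,
      List.cons_append, mergeAt_append hj ha, List.append_assoc, List.cons_append]
  have entl : ∀ j, 1 ≤ j → j ≤ k + 2 → ent (l ++ [1]) j = ent l j := fun j h1 h2 =>
    ent_append_left h1 (by omega)
  have last : ent (l ++ [1]) (k + 2 + 1) = 1 := ent_append_fst (by simp [hk])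
  have mergeLast : mergeAt (l ++ [1]) (k + 2) (ent l (k + 2) + 1 - 1) = l := by
    have hi : k + 1 < l.length := by omega
    have e := List.drop_eq_getElem_cons hi
    have hent : ent l (k + 2) = l[k + 1] := by simp [ent, hi]
    rw [Nat.add_sub_cancel, hent, mergeAt, List.take_append_of_le_length (by omega),
      List.drop_of_length_le (by simp [hk])]
    have hd : l.drop (k + 1 + 1) = [] := List.drop_of_length_le (by omega)
    rw [hd] at e
    rw [← e]
    exact List.take_append_drop _ _
  have hpos : (ent l (k + 2) : ℚ) ≠ 0 := by
    have hi : k + 1 < l.length := by omega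
    have := h _ (List.getElem_mem hi)
    have hent : ent l (k + 2) = l[k + 1] := by simp [ent, hi]
    rw [hent]
    exact_mod_cast (by omega : l[k + 1] ≠ 0)
  have hw : ((ent l (k + 2) : ℚ) - 1) + ∑ t ∈ Icc 1 (k + 1), ((ent l t : ℚ) - 1) = weight l := by
    rw [← sum_ent_sub_one, hk, Finset.sum_Icc_succ_top (by omega : 1 ≤ k + 1 + 1), add_comm]
  rw [deltaFun_of_two_le (by simp; omega) (by simpa using h),
    deltaFun_of_two_le hl fun a ha => h a (List.mem_of_mem_dropLast ha)]
  simp only [List.length_append, List.length_singleton, hk, Nat.add_sub_cancel,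
    show k + 2 - 1 = k + 1 by omega]
  rw [Finset.sum_Icc_succ_top (by omega : 1 ≤ k + 1 + 1),
    Finset.sum_Icc_succ_top (by omega : 2 ≤ k + 1 + 1),
    Finset.sum_Icc_succ_top (by omega : 2 ≤ k + 1 + 1)]
  simp only [map_add, map_sum, map_smul, Nat.add_sub_cancel]
  have regroup : ∀ {u v w u' v' w' x y z r : AnickSpace}, u = u' → v = v' → w = w' →
      x + y + z = r → u + x + (v + y) + (w + z) = u' + v' + w' + r := by
    rintro u v w _ _ _ x y z _ rfl rfl rfl rfl
    abel
  refine regroup ?_ ?_ ?_ ?_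
  · refine Finset.sum_congr rfl fun j hj => ?_
    rw [mem_Icc] at hj
    rw [entl j hj.1 (by omega), entl (j + 1) (by omega) (by omega), merge j _ hj.1 hj.2]
  · refine Finset.sum_congr rfl fun j hj => Finset.sum_congr rfl fun t ht => ?_
    rw [mem_Icc] at hj ht
    rw [entl j (by omega) (by omega), entl (j + 1) (by omega) (by omega),
      entl t ht.1 (by omega), decMerge j t _ ht.1 ht.2 hj.2]
  · refine Finset.sum_congr rfl fun j hj => Finset.sum_congr rfl fun t ht => ?_
    rw [mem_Icc] at hj ht
    rw [entl j (by omega) (by omega), entl (j + 1) (by omega) (by omega),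
      entl t ht.1 (by omega), merge j _ (by omega) hj.2]
  · rw [entl (k + 1 + 1) (by omega) le_rfl, last, mergeLast]
    have hsum : ∑ t ∈ Icc 1 (k + 1), ((-1 : ℚ) ^ (k + 2) *
        ((ent l (k + 2) : ℚ) * ((1 : ℕ) : ℚ) * (ent (l ++ [1]) t - 1) /
          (ent l (k + 2) + ((1 : ℕ) : ℚ) - 1))) • br l =
        ((-1 : ℚ) ^ (k + 2) * ∑ t ∈ Icc 1 (k + 1), ((ent l t : ℚ) - 1)) • br l := by
      rw [← Finset.sum_smul, ← Finset.mul_sum]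
      congr 2
      refine Finset.sum_congr rfl fun t ht => ?_
      rw [mem_Icc] at ht
      rw [entl t ht.1 (by omega)]
      rw [Nat.cast_one, mul_one, add_sub_cancel_right, mul_div_cancel_left₀ _ hpos]
    rw [hsum, ← hw]
    simp only [Nat.cast_one, sub_self, mul_zero, zero_div, zero_smul, Finset.sum_const_zero,
      add_zero, add_sub_cancel_right]
    rw [← add_smul, ← mul_add, mul_div_cancel_left₀ _ hpos]

theorem two_le_of_mem_Ak {n k : ℕ} (hk : 2 ≤ k) {c : {l : List ℕ // AnickChain l}}
    (hc : c.1.length = n ∧ k ≤ c.1.getD (n - 1) 0) : ∀ a ∈ c.1, 2 ≤ a :=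
  c.2.two_le_of_two_le_last (by rw [hc.1]; exact hk.trans hc.2)

theorem anickDelta_single (c : {l : List ℕ // AnickChain l}) :
    anickDelta (Finsupp.single c 1) = deltaFun c.1 := by
  simp [anickDelta]

theorem anickDelta_appendOne {n : ℕ} (hn : 2 ≤ n) {x : AnickSpace} (hx : x ∈ Ak n 2) :
    anickDelta (appendOne x) =
      appendOne (anickDelta x) + (-1 : ℚ) ^ n • scaleWeight id x := by
  refine eq_of_mem_supported (f := anickDelta ∘ₗ appendOne)
    (g := appendOne ∘ₗ anickDelta + (-1 : ℚ) ^ n • scaleWeight id) (fun c hc => ?_) hx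
  have h2 := two_le_of_mem_Ak le_rfl hc
  have hne : c.1 ≠ [] := c.2.1
  have hs : Finsupp.single c (1 : ℚ) = br c.1 := (br_of_anickChain c.2).symm
  have hchain : AnickChain (c.1 ++ [1]) := (anickChain_concat_iff one_ne_zero).2 h2
  simp only [LinearMap.add_apply, LinearMap.comp_apply, LinearMap.smul_apply,
    scaleWeight_single, anickDelta_single, id]
  rw [hs, appendOne_br hne, br_of_anickChain hchain, anickDelta_single,
    deltaFun_append_one (by rw [hc.1]; exact hn) h2, hc.1, mul_smul]

theorem anickDelta_scaleWeight {n : ℕ} (hn : 2 ≤ n) (f : ℚ → ℚ) {x : AnickSpace}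
    (hx : x ∈ Ak n 2) : anickDelta (scaleWeight f x) = scaleWeight f (anickDelta x) := by
  refine eq_of_mem_supported (f := anickDelta ∘ₗ scaleWeight f)
    (g := scaleWeight f ∘ₗ anickDelta) (fun c hc => ?_) hx
  simp only [LinearMap.comp_apply, scaleWeight_single, anickDelta_single, map_smul]
  exact eq_of_mem_supported (f := f (weight c.1) • LinearMap.id) (g := scaleWeight f)
    (fun d hd => by simp [scaleWeight_single, hd.1])
    (deltaFun_mem_supported (by rw [hc.1]; exact hn) (two_le_of_mem_Ak le_rfl hc))

theorem anickDelta_mem_supported {n : ℕ} (hn : 2 ≤ n) {x : AnickSpace} (hx : x ∈ Ak n 2) :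
    anickDelta x ∈ Finsupp.supported ℚ ℚ
      {c : {l : List ℕ // AnickChain l} | 2 ≤ c.1.getD (c.1.length - 1) 0} := by
  refine map_mem_of_mem_supported (fun c hc => ?_) hx
  rw [anickDelta_single]
  exact Finsupp.supported_mono (fun d hd => hd.2)
    (deltaFun_mem_supported (by rw [hc.1]; exact hn) (two_le_of_mem_Ak le_rfl hc))

theorem scaleWeight_mem_supported (f : ℚ → ℚ) {s : Set {l : List ℕ // AnickChain l}}
    {x : AnickSpace} (hx : x ∈ Finsupp.supported ℚ ℚ s) :
    scaleWeight f x ∈ Finsupp.supported ℚ ℚ s := by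
  refine map_mem_of_mem_supported (fun c hc => ?_) hx
  rw [scaleWeight_single]
  exact Submodule.smul_mem _ _ (Finsupp.single_mem_supported ℚ 1 hc)

theorem scaleWeight_inv_scaleWeight {n : ℕ} {x : AnickSpace} (hx : x ∈ Ak n 2) :
    scaleWeight (fun r => r⁻¹) (scaleWeight id x) = x := by
  refine eq_of_mem_supported (f := scaleWeight (fun r => r⁻¹) ∘ₗ scaleWeight id)
    (g := LinearMap.id) (fun c hc => ?_) hx
  have h := (weight_pos c.2.1 (two_le_of_mem_Ak le_rfl hc)).ne'
  simp only [LinearMap.comp_apply, scaleWeight_single, map_smul, smul_smul, id,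
    LinearMap.id_apply, mul_inv_cancel₀ h, one_smul]

theorem scaleWeight_scaleWeight_inv {n : ℕ} {x : AnickSpace} (hx : x ∈ Ak n 2) :
    scaleWeight id (scaleWeight (fun r => r⁻¹) x) = x := by
  refine eq_of_mem_supported (f := scaleWeight id ∘ₗ scaleWeight (fun r => r⁻¹))
    (g := LinearMap.id) (fun c hc => ?_) hx
  have h := (weight_pos c.2.1 (two_le_of_mem_Ak le_rfl hc)).ne'
  simp only [LinearMap.comp_apply, scaleWeight_single, map_smul, smul_smul, id,
    LinearMap.id_apply, inv_mul_cancel₀ h, one_smul]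

theorem appendOne_mem_supported (x : AnickSpace) :
    appendOne x ∈ Finsupp.supported ℚ ℚ
      {c : {l : List ℕ // AnickChain l} | c.1.getD (c.1.length - 1) 0 = 1} := by
  refine map_mem_of_mem_supported (s := Set.univ) (fun c _ => ?_) (by simp)
  rw [← br_of_anickChain c.2, appendOne_br c.2.1]
  exact br_mem_supported fun _ => by simp

theorem appendOne_mem_Ak {n : ℕ} {x : AnickSpace} (hx : x ∈ Ak n 2) :
    appendOne x ∈ Ak (n + 1) 1 := by
  refine map_mem_of_mem_supported (fun c hc => ?_) hx
  rw [← br_of_anickChain c.2, appendOne_br c.2.1]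
  exact br_mem_supported fun _ => ⟨by simp [hc.1], by simp [← hc.1]⟩

theorem exists_eq_appendOne_add {n : ℕ} (hn : n ≠ 0) {u : AnickSpace} (hu : u ∈ Ak (n + 1) 1) :
    ∃ x ∈ Ak n 2, ∃ y ∈ Ak (n + 1) 2, appendOne x + y = u := by
  have : u ∈ (Ak n 2).map appendOne ⊔ Ak (n + 1) 2 := by
    refine map_mem_of_mem_supported (f := LinearMap.id) (fun c hc => ?_) hu
    obtain ⟨l, hl⟩ := c
    obtain ⟨hlen, hlast⟩ := hc
    rcases List.eq_nil_or_concat' l with rfl | ⟨l, m, rfl⟩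
    · simp at hlen
    obtain rfl : l.length = n := by simpa using hlen
    have hm : 1 ≤ m := by simpa using hlast
    have hreg := (anickChain_concat_iff (by omega)).1 hl
    have hne : l ≠ [] := by simpa using hn
    rcases hm.eq_or_lt with rfl | hm
    · refine Submodule.mem_sup_left ⟨br l, br_mem_supported fun _ => ⟨rfl, ?_⟩, ?_⟩
      · have hi : l.length - 1 < l.length := by omega
        simpa [hi] using hreg _ (List.getElem_mem hi)
      · rw [appendOne_br hne, br_of_anickChain hl, LinearMap.id_apply]
    · refine Submodule.mem_sup_right (Finsupp.single_mem_supported ℚ 1 ⟨hlen, ?_⟩)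
      simpa using Nat.succ_le_of_lt hm
  obtain ⟨_, ⟨x, hx, rfl⟩, y, hy, h⟩ := Submodule.mem_sup.1 this
  exact ⟨x, hx, y, hy, h⟩

/-- if `n ≥ 3`, `u ∈ A_{n,1}` and `δ_n(u) = 0`, then `u = δ_{n+1}(w)`
for some `w ∈ A_{n+1,1}`. -/
theorem cycles_in_Ak1_are_boundaries (n : ℕ) (hn : 3 ≤ n) :
    ∀ u ∈ Ak n 1, anickDelta u = 0 → ∃ w ∈ Ak (n + 1) 1, anickDelta w = u := by
  intro u hu hδ
  obtain ⟨m, rfl⟩ : ∃ m, n = m + 1 := ⟨n - 1, by omega⟩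
  obtain ⟨x, hx, y, hy, rfl⟩ := exists_eq_appendOne_add (by omega) hu
  rw [map_add, anickDelta_appendOne (by omega) hx, add_assoc] at hδ
  have hlast : (-1 : ℚ) ^ m • scaleWeight id x + anickDelta y ∈ Finsupp.supported ℚ ℚ
      {c : {l : List ℕ // AnickChain l} | 2 ≤ c.1.getD (c.1.length - 1) 0} := by
    refine add_mem (Submodule.smul_mem _ _ (scaleWeight_mem_supported _ ?_))
      (anickDelta_mem_supported (by omega) hy)
    refine Finsupp.supported_mono (fun c hc => ?_) hx
    change 2 ≤ c.1.getD (c.1.length - 1) 0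
    rw [hc.1]
    exact hc.2
  have hzero : (-1 : ℚ) ^ m • scaleWeight id x + anickDelta y = 0 := by
    refine Submodule.disjoint_def.1 (Finsupp.disjoint_supported_supported (R := ℚ) (M := ℚ) ?_)
      _ hlast (eq_neg_of_add_eq_zero_right hδ ▸ neg_mem (appendOne_mem_supported _))
    refine Set.disjoint_left.2 fun c (h2 : 2 ≤ _) (h1 : _ = 1) => ?_
    omega
  refine ⟨(-1 : ℚ) ^ (m + 1) • appendOne (scaleWeight (fun r => r⁻¹) y),
    Submodule.smul_mem _ _ (appendOne_mem_Ak (scaleWeight_mem_supported _ hy)), ?_⟩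
  have hsq : ((-1 : ℚ) ^ m) * (-1) ^ m = 1 := by rw [← mul_pow]; simp
  rw [map_smul, anickDelta_appendOne (by omega) (scaleWeight_mem_supported _ hy),
    anickDelta_scaleWeight (by omega) _ hy, eq_neg_of_add_eq_zero_right hzero,
    scaleWeight_scaleWeight_inv hy]
  simp only [map_neg, map_smul, scaleWeight_inv_scaleWeight hx]
  rw [smul_add, smul_smul, pow_succ, smul_neg, smul_smul]
  simp [hsq]
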